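/- Suppose the stationary measure ℙ satisfies conditions ID, FE and KB, and let ℚ be an ergodic stationary measure with supp ℚ ⊆ supp ℙ. Then the specific cross entropy h_c(ℚ|ℙ) exists and is finite, and for ℚ-almost every y and ℙ-almost every x, limsup_{N→∞} Q̂_N(y,x) ≤ h_c(ℚ|ℙ). -/

import Mathlib

open MeasureTheory Filter Asymptotics
open scoped ENNReal Classical

noncomputable section

namespace ZM

/-- The left shift on one-sided sequences. -/
def shift {A : Type*} (x : ℕ → A) : ℕ → A := fun k => x (k + 1)

/-- The cylinder set of all sequences starting with the word `a`. -/
def cyl {A : Type*} {n : ℕ} (a : Fin n → A) : Set (ℕ → A) := {x | ∀ i : Fin n, x i = a i}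

/-- The word `x_{p+1}^{p+ℓ}` of `x` (0-based: the letters at positions `p, …, p+ℓ-1`). -/
def seg {A : Type*} (y : ℕ → A) (p ℓ : ℕ) : Fin ℓ → A := fun i => y (p + i)

/-- `w` occurs in `x` at (0-based) offset `r`. -/
def matchAt {A : Type*} (x : ℕ → A) {ℓ : ℕ} (w : Fin ℓ → A) (r : ℕ) : Prop :=
  ∀ i : Fin ℓ, x (r + i) = w i

/-- `w` appears as a substring of `x_1^N`. -/
def appears {A : Type*} (N : ℕ) (x : ℕ → A) {ℓ : ℕ} (w : Fin ℓ → A) : Prop :=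
  ∃ r, r + ℓ ≤ N ∧ matchAt x w r

/-- The waiting time `W_ℓ(w, x)`: the least (1-based) position at which `w` occurs in `x`,
`⊤` if `w` never occurs. -/
def W {A : Type*} {ℓ : ℕ} (w : Fin ℓ → A) (x : ℕ → A) : ℕ∞ :=
  sInf {r : ℕ∞ | ∃ n : ℕ, r = (n : ℕ∞) ∧ 1 ≤ n ∧ matchAt x w (n - 1)}

section ZMparsing

variable {A : Type*}

/-- Length of the Ziv–Merhav word starting at (0-based) position `p` of `y_1^N`, with
database `x_1^N`: the longest prefix of the remaining portion of `y_1^N` appearing as a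
substring of `x_1^N`, or a single letter if there is no such prefix. -/
def zmLen (N : ℕ) (x y : ℕ → A) (p : ℕ) : ℕ :=
  max 1 (sSup {ℓ | p + ℓ ≤ N ∧ appears N x (seg y p ℓ)})

/-- Starting position of the `j`-th (0-based) word of the Ziv–Merhav parsing. -/
def zmPos (N : ℕ) (x y : ℕ → A) : ℕ → ℕ
  | 0 => 0
  | j + 1 => zmPos N x y j + zmLen N x y (zmPos N x y j)

/-- `c_N(y|x)`: the number of words in the Ziv–Merhav parsing of `y_1^N` w.r.t. `x_1^N`. -/
def cN (N : ℕ) (x y : ℕ → A) : ℕ := sInf {c | N ≤ zmPos N x y c}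

/-- The Ziv–Merhav estimator `Q̂_N(y, x) = c_N(y|x) ln N / N`. -/
def ZMest (N : ℕ) (x y : ℕ → A) : ℝ := (cN N x y : ℝ) * Real.log N / N

end ZMparsing

section MeasureDefs

variable {A : Type*} [MeasurableSpace A]

/-- The measure of the cylinder of a word, as a real number. -/
def wp (μ : Measure (ℕ → A)) {n : ℕ} (a : Fin n → A) : ℝ := (μ (cyl a)).toReal

/-- `supp ℙ`: the set of sequences all of whose prefixes have positive measure. -/
def suppSet (μ : Measure (ℕ → A)) : Set (ℕ → A) := {x | ∀ n, 0 < μ (cyl (seg x 0 n))}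

/-- Condition (ID): immediate decoupling on the support, with sequence `k`. -/
def CondID (μ : Measure (ℕ → A)) (k : ℕ → ℝ) : Prop :=
  Monotone k ∧ (k =o[atTop] fun n => (n : ℝ)) ∧
    ∀ (n m : ℕ) (a : Fin n → A) (b : Fin m → A), 0 < μ (cyl a) → 0 < μ (cyl b) →
      wp μ (Fin.append a b) ≤ Real.exp (k n) * (wp μ a * wp μ b) ∧
      (0 < μ (cyl (Fin.append a b)) →
        Real.exp (-k n) * (wp μ a * wp μ b) ≤ wp μ (Fin.append a b))

/-- Condition (FE): fast enough decay, with rate `γp < 0`. -/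
def CondFE (μ : Measure (ℕ → A)) (γp : ℝ) : Prop :=
  γp < 0 ∧ ∀ᶠ n : ℕ in atTop, ∀ a : Fin n → A, 0 < μ (cyl a) → wp μ a ≤ Real.exp (γp * n)

/-- Condition (SE): slow enough decay, with rate `γm < 0`. -/
def CondSE (μ : Measure (ℕ → A)) (γm : ℝ) : Prop :=
  γm < 0 ∧ ∀ᶠ n : ℕ in atTop, ∀ a : Fin n → A, 0 < μ (cyl a) → Real.exp (γm * n) ≤ wp μ a

/-- Condition (KB): Kontoyiannis' bound on waiting times, with sequences `k`, `τ`. -/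
def CondKB (μ : Measure (ℕ → A)) (k τ : ℕ → ℝ) : Prop :=
  (k =o[atTop] fun n => (n : ℝ)) ∧ (τ =o[atTop] fun n => (n : ℝ)) ∧
    ∀ (ℓ : ℕ) (a : Fin ℓ → A) (r : ℕ),
      (μ {x | (r : ℕ∞) ≤ W a x}).toReal ≤
        Real.exp (-(Real.exp (-k ℓ) * wp μ a * (⌊((r : ℝ) - 1) / ((ℓ : ℝ) + τ ℓ)⌋ : ℝ)))

/-- Length of the next word of the auxiliary parsing of `y_1^N` starting at position `p`:
the shortest prefix of the remaining portion of `y_1^N` with measure at most `θ`, or the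
whole remaining portion if there is no such prefix. -/
def auxLen (μ : Measure (ℕ → A)) (θ : ℝ) (N : ℕ) (y : ℕ → A) (p : ℕ) : ℕ :=
  if ∃ ℓ, 1 ≤ ℓ ∧ p + ℓ ≤ N ∧ wp μ (seg y p ℓ) ≤ θ then
    sInf {ℓ | 1 ≤ ℓ ∧ p + ℓ ≤ N ∧ wp μ (seg y p ℓ) ≤ θ}
  else N - p

/-- Starting position of the `j`-th (0-based) word of the auxiliary parsing. -/
def auxPos (μ : Measure (ℕ → A)) (θ : ℝ) (N : ℕ) (y : ℕ → A) : ℕ → ℕ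
  | 0 => 0
  | j + 1 => auxPos μ θ N y j + max 1 (auxLen μ θ N y (auxPos μ θ N y j))

/-- Length of the `j`-th (0-based) word of the auxiliary parsing. -/
def auxWordLen (μ : Measure (ℕ → A)) (θ : ℝ) (N : ℕ) (y : ℕ → A) (j : ℕ) : ℕ :=
  max 1 (auxLen μ θ N y (auxPos μ θ N y j))

/-- The number of words in the auxiliary parsing of `y_1^N`. -/
def auxCount (μ : Measure (ℕ → A)) (θ : ℝ) (N : ℕ) (y : ℕ → A) : ℕ :=
  sInf {c | N ≤ auxPos μ θ N y c}

/-- Length of the next word of the block parsing within a block ending at position `e`: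
the shortest prefix of the remaining portion of the block with measure at most `θ`;
`0` encodes that no such prefix exists (the rest of the block is the buffer). -/
def blkLen (μ : Measure (ℕ → A)) (θ : ℝ) (e : ℕ) (y : ℕ → A) (p : ℕ) : ℕ :=
  sInf {ℓ | 1 ≤ ℓ ∧ p + ℓ ≤ e ∧ wp μ (seg y p ℓ) ≤ θ}

/-- Starting position of the `i`-th (0-based) word of the block starting at `q`, ending at `e`. -/
def blkPos (μ : Measure (ℕ → A)) (θ : ℝ) (e : ℕ) (y : ℕ → A) (q : ℕ) : ℕ → ℕ
  | 0 => q
  | i + 1 => blkPos μ θ e y q i + blkLen μ θ e y (blkPos μ θ e y q i)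

/-- Number `d_s` of words in the block starting at `q` and ending at `e`. -/
def dCount (μ : Measure (ℕ → A)) (θ : ℝ) (e : ℕ) (y : ℕ → A) (q : ℕ) : ℕ :=
  sInf {i | blkLen μ θ e y (blkPos μ θ e y q i) = 0}

/-- The block starting at `q` and ending at `e` is good: its parsed words are pairwise
distinct. -/
def GoodBlock (μ : Measure (ℕ → A)) (θ : ℝ) (e : ℕ) (y : ℕ → A) (q : ℕ) : Prop :=
  ∀ i j : ℕ, i < dCount μ θ e y q → j < dCount μ θ e y q →
    blkLen μ θ e y (blkPos μ θ e y q i) = blkLen μ θ e y (blkPos μ θ e y q j) →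
    (∀ t < blkLen μ θ e y (blkPos μ θ e y q i),
      y (blkPos μ θ e y q i + t) = y (blkPos μ θ e y q j + t)) →
    i = j

end MeasureDefs

/-- The block length `⌊N^α⌋`. -/
def blockB (N : ℕ) (α : ℝ) : ℕ := ⌊(N : ℝ) ^ α⌋₊

/-- The number `M_N` of blocks. -/
def blockM (N : ℕ) (α : ℝ) : ℕ := (N + blockB N α - 1) / blockB N α

/-- The starting position of the `s`-th (0-based) block. -/
def blockStart (N : ℕ) (α : ℝ) (s : ℕ) : ℕ := s * blockB N α

/-- The end position of the `s`-th (0-based) block. -/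
def blockEnd (N : ℕ) (α : ℝ) (s : ℕ) : ℕ := min ((s + 1) * blockB N α) N

/-- `S_b(y_1^N)`: the set of bad blocks of the block auxiliary parsing (with threshold
`N^{-1-ε}`, word probabilities computed with `μ`). -/
def badSet {A : Type*} [MeasurableSpace A] (μ : Measure (ℕ → A)) (N : ℕ) (α ε : ℝ)
    (y : ℕ → A) : Set ℕ :=
  {s | s < blockM N α ∧
    ¬ GoodBlock μ ((N : ℝ) ^ (-1 - ε)) (blockEnd N α s) y (blockStart N α s)}

/-- `ℓ₋ = ln N / (-2 γ₋)`. -/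
def ellMinus (N : ℕ) (γm : ℝ) : ℝ := Real.log N / (-2 * γm)

/-- `ℓ₊ = 2 ln N / (-γ₊)`. -/
def ellPlus (N : ℕ) (γp : ℝ) : ℝ := 2 * Real.log N / (-γp)

/-- `d₊ = 2 N^α / ℓ₋`. -/
def dPlus (N : ℕ) (α γm : ℝ) : ℝ := 2 * (N : ℝ) ^ α / ellMinus N γm

section CrossEntropy

variable {A : Type*} [MeasurableSpace A] [Fintype A]

/-- The `n`-th cross-entropy average `-(1/n) ∑_{a ∈ 𝒜ⁿ} ℚ[a] ln ℙ[a]`, real-valued version. -/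
def hcSeq (μP μQ : Measure (ℕ → A)) (n : ℕ) : ℝ :=
  -(1 / (n : ℝ)) * ∑ a : Fin n → A, wp μQ a * Real.log (wp μP a)

/-- `-ln p` as an element of `[0, ∞]`, for `p ∈ [0, 1]`; equals `⊤` when `p = 0`. -/
def negLog (p : ℝ≥0∞) : ℝ≥0∞ := if p = 0 then ⊤ else ENNReal.ofReal (-Real.log p.toReal)

/-- The `n`-th cross-entropy average, `[0, ∞]`-valued version. -/
def hcSeqE (μP μQ : Measure (ℕ → A)) (n : ℕ) : ℝ≥0∞ :=
  (∑ a : Fin n → A, μQ (cyl a) * negLog (μP (cyl a))) / (n : ℝ≥0∞)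

end CrossEntropy

end ZM

theorem Finset.sum_range_mul_eq_sum_sum (f : ℕ → ℝ) (m q : ℕ) :
    ∑ i ∈ Finset.range (m * q), f i =
      ∑ j ∈ Finset.range m, ∑ l ∈ Finset.range q, f (j + m * l) := by
  induction q with
  | zero => simp
  | succ q ih =>
    simp only [Finset.sum_range_succ, Finset.sum_add_distrib, ← ih]
    rw [mul_add, mul_one, Finset.sum_range_add]
    simp only [add_comm]

section Ergodic

variable {α : Type*} {T : α → α}

/-- The maximum of the Birkhoff sums `S_0, …, S_n` of `g`. -/
def birkhoffMax (T : α → α) (g : α → ℝ) : ℕ → α → ℝ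
  | 0 => fun _ => 0
  | n + 1 => fun x => max 0 (g x + birkhoffMax T g n (T x))

theorem birkhoffMax_nonneg (g : α → ℝ) (n : ℕ) (x : α) : 0 ≤ birkhoffMax T g n x := by
  cases n with
  | zero => exact le_rfl
  | succ n => exact le_max_left _ _

theorem birkhoffMax_le_succ (g : α → ℝ) (n : ℕ) (x : α) :
    birkhoffMax T g n x ≤ birkhoffMax T g (n + 1) x := by
  induction n generalizing x with
  | zero => exact birkhoffMax_nonneg g 1 x
  | succ n ih => exact max_le_max le_rfl (by gcongr; exact ih (T x))

theorem birkhoffSum_le_birkhoffMax (g : α → ℝ) (n : ℕ) (x : α) :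
    birkhoffSum T g n x ≤ birkhoffMax T g n x := by
  induction n generalizing x with
  | zero => simp [birkhoffMax]
  | succ n ih =>
    rw [birkhoffSum_succ']
    exact le_trans (by gcongr; exact ih (T x)) (le_max_right _ _)

variable [MeasurableSpace α] {μ : Measure α}

theorem integrable_birkhoffMax (hT : MeasurePreserving T μ μ) {g : α → ℝ}
    (hg : Integrable g μ) (n : ℕ) : Integrable (birkhoffMax T g n) μ := by
  induction n with
  | zero => exact integrable_zero _ _ _
  | succ n ih => exact (integrable_zero _ _ _).sup (hg.add (hT.integrable_comp_of_integrable ih))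

/-- A form of the maximal ergodic theorem. -/
theorem integral_nonneg_of_exists_birkhoffSum_pos (hT : MeasurePreserving T μ μ) {g : α → ℝ}
    (hg : Integrable g μ) (hpos : ∀ᵐ x ∂μ, ∃ n, 0 < birkhoffSum T g n x) :
    0 ≤ ∫ x, g x ∂μ := by
  have hnull : ∀ n, NullMeasurableSet {x | 0 < birkhoffMax T g n x} μ := fun n =>
    nullMeasurableSet_lt aemeasurable_const (integrable_birkhoffMax hT hg n).aemeasurable
  have hlim : Tendsto (fun n => ∫ x, {x | 0 < birkhoffMax T g (n + 1) x}.indicator g x ∂μ) atTop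
      (nhds (∫ x, g x ∂μ)) := by
    refine tendsto_integral_of_dominated_convergence (fun x => ‖g x‖) (fun n => ?_) hg.norm
      (fun n => ?_) ?_
    · exact hg.aestronglyMeasurable.indicator₀ (hnull _)
    · exact Eventually.of_forall fun x => norm_indicator_le_norm_self _ _
    · filter_upwards [hpos] with x ⟨n, hn⟩
      refine tendsto_const_nhds.congr' ?_
      filter_upwards [eventually_ge_atTop n] with m hm
      have hmono : Monotone fun i => birkhoffMax T g i x :=
        monotone_nat_of_le_succ fun i => birkhoffMax_le_succ g i x
      have : 0 < birkhoffMax T g (m + 1) x :=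
        (hn.trans_le (birkhoffSum_le_birkhoffMax g n x)).trans_le (hmono (by omega))
      rw [Set.indicator_of_mem (by exact this)]
  refine ge_of_tendsto' hlim fun n => ?_
  have h1 := integrable_birkhoffMax hT hg n
  have h2 := integrable_birkhoffMax hT hg (n + 1)
  have h1T : Integrable (fun x => birkhoffMax T g n (T x)) μ :=
    hT.integrable_comp_of_integrable h1
  have hcomp : ∫ x, birkhoffMax T g n (T x) ∂μ = ∫ x, birkhoffMax T g n x ∂μ := by
    rw [← integral_map hT.aemeasurable (by rw [hT.map_eq]; exact h1.aestronglyMeasurable),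
      hT.map_eq]
  calc 0 ≤ ∫ x, birkhoffMax T g (n + 1) x ∂μ - ∫ x, birkhoffMax T g n x ∂μ :=
        sub_nonneg.2 (integral_mono h1 h2 fun x => birkhoffMax_le_succ g n x)
    _ = ∫ x, (birkhoffMax T g (n + 1) x - birkhoffMax T g n (T x)) ∂μ := by
        rw [integral_sub h2 h1T, hcomp]
    _ ≤ _ := by
        refine integral_mono (h2.sub h1T) (hg.indicator₀ (hnull _)) fun x => ?_
        by_cases hx : 0 < birkhoffMax T g (n + 1) x
        · rw [Set.indicator_of_mem (by exact hx)]
          have : birkhoffMax T g (n + 1) x ≤ g x + birkhoffMax T g n (T x) := by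
            by_contra! hlt
            exact (max_lt hx hlt).ne rfl
          simp only
          linarith
        · rw [Set.indicator_of_notMem (by exact hx)]
          have := birkhoffMax_nonneg (T := T) g n (T x)
          simp only
          linarith

/-- Birkhoff sums of a function with negative mean are almost surely bounded above. -/
theorem Ergodic.ae_bddAbove_birkhoffSum [IsProbabilityMeasure μ] (hT : Ergodic T μ) {g : α → ℝ}
    (hg : Integrable g μ) (hneg : ∫ x, g x ∂μ < 0) :
    ∀ᵐ x ∂μ, BddAbove (Set.range fun n => birkhoffSum T g n x) := by
  have hmeas : ∀ n, AEMeasurable (fun x => birkhoffSum T g n x) μ := fun n =>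
    Finset.aemeasurable_fun_sum _ fun i _ =>
      hg.aemeasurable.comp_quasiMeasurePreserving
        (hT.toMeasurePreserving.iterate i).quasiMeasurePreserving
  have hset : {x | BddAbove (Set.range fun n => birkhoffSum T g n x)} =
      ⋃ K : ℕ, ⋂ n, {x | birkhoffSum T g n x ≤ K} := by
    ext x
    simp only [Set.mem_ofPred_eq, Set.mem_iUnion, Set.mem_iInter, bddAbove_def,
      Set.forall_mem_range]
    constructor
    · rintro ⟨K, hK⟩
      obtain ⟨m, hm⟩ := exists_nat_ge K
      exact ⟨m, fun n => (hK n).trans hm⟩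
    · rintro ⟨K, hK⟩
      exact ⟨K, hK⟩
  have hnull : NullMeasurableSet {x | BddAbove (Set.range fun n => birkhoffSum T g n x)} μ := by
    rw [hset]
    exact NullMeasurableSet.iUnion fun K => NullMeasurableSet.iInter fun n =>
      nullMeasurableSet_le (hmeas n) aemeasurable_const
  have hinv : T ⁻¹' {x | BddAbove (Set.range fun n => birkhoffSum T g n x)} =
      {x | BddAbove (Set.range fun n => birkhoffSum T g n x)} := by
    ext x
    simp only [Set.mem_preimage, Set.mem_ofPred_eq, bddAbove_def, Set.forall_mem_range]
    constructor
    · rintro ⟨K, hK⟩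
      refine ⟨max 0 (g x + K), fun n => ?_⟩
      cases n with
      | zero => simp
      | succ n =>
        rw [birkhoffSum_succ']
        exact le_trans (by gcongr; exact hK n) (le_max_right _ _)
    · rintro ⟨K, hK⟩
      refine ⟨K - g x, fun n => ?_⟩
      have := hK (n + 1)
      rw [birkhoffSum_succ'] at this
      linarith
  rcases hT.quasiErgodic.ae_mem_or_ae_notMem₀ hnull (by rw [hinv]; rfl) with h | h
  · exact h
  · refine absurd (integral_nonneg_of_exists_birkhoffSum_pos hT.toMeasurePreserving hg ?_)
      (not_le.2 hneg)
    filter_upwards [h] with x hx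
    by_contra! hx'
    exact hx ⟨0, Set.forall_mem_range.2 hx'⟩

end Ergodic

namespace ZM

/-- A two-parameter family (think of `-ln ℙ[y_{p+1}^{p+n}]`) that is additive up to the
error `k`. -/
structure AlmostAdditive (G : ℕ → ℕ → ℝ) (k : ℕ → ℝ) (C : ℝ) : Prop where
  zero : ∀ p, G p 0 = 0
  mono : ∀ p, Monotone (G p)
  le_add : ∀ p n m, G p (n + m) ≤ G p n + G (p + n) m + k n
  add_le : ∀ p n m, G p n + G (p + n) m ≤ G p (n + m) + k n
  le_mul : ∀ p n, G p n ≤ C * n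

namespace AlmostAdditive

variable {G : ℕ → ℕ → ℝ} {k : ℕ → ℝ} {C : ℝ}

theorem nonneg (h : AlmostAdditive G k C) (p n : ℕ) : 0 ≤ G p n :=
  (h.zero p).symm.le.trans (h.mono p n.zero_le)

theorem const_nonneg (h : AlmostAdditive G k C) : 0 ≤ C := by
  simpa using (h.nonneg 0 1).trans (h.le_mul 0 1)

theorem error_nonneg (h : AlmostAdditive G k C) (n : ℕ) : 0 ≤ k n := by
  have := h.add_le 0 n 0
  simpa [h.zero] using this

theorem sum_le (h : AlmostAdditive G k C) (i : ℕ) (Z : ℕ → ℕ) (p : ℕ) :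
    ∑ j ∈ Finset.range i, G (p + ∑ t ∈ Finset.range j, Z t) (Z j) ≤
      G p (∑ t ∈ Finset.range i, Z t) + ∑ j ∈ Finset.range i, k (Z j) := by
  induction i generalizing Z p with
  | zero => simp [h.zero]
  | succ i ih =>
    have h1 := ih (fun j => Z (j + 1)) (p + Z 0)
    have h2 := h.add_le p (Z 0) (∑ t ∈ Finset.range i, Z (t + 1))
    rw [Finset.sum_range_succ', Finset.sum_range_succ' Z, Finset.sum_range_succ' fun j => k (Z j)]
    simp only [Finset.sum_range_zero, add_zero]
    have h3 : ∀ j, p + ∑ t ∈ Finset.range (j + 1), Z t =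
        p + Z 0 + ∑ t ∈ Finset.range j, Z (t + 1) := fun j => by
      rw [Finset.sum_range_succ']; omega
    simp only [h3]
    rw [add_comm (∑ t ∈ Finset.range i, Z (t + 1)) (Z 0)]
    linarith

theorem mul_le_sum (h : AlmostAdditive G k C) (m q p : ℕ) :
    G p (m * q) ≤ ∑ l ∈ Finset.range q, (G (p + m * l) m + k m) := by
  induction q generalizing p with
  | zero => simp [h.zero]
  | succ q ih =>
    have h1 := h.le_add p m (m * q)
    have h2 := ih (p + m)
    rw [Finset.sum_range_succ', show m * (q + 1) = m + m * q by ring]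
    have h3 : ∀ l, p + m * (l + 1) = p + m + m * l := fun l => by ring
    simp only [h3, mul_zero, add_zero]
    linarith

theorem mul_le_birkhoff (h : AlmostAdditive G k C) (hk : Monotone k) {m q N : ℕ}
    (hN : N ≤ m * q) :
    m * G 0 N ≤ m * (C * m + k m) + (∑ i ∈ Finset.range (m * q), G i m + m * q * k m) := by
  have hC := h.const_nonneg
  have key : ∀ j ∈ Finset.range m,
      G 0 N ≤ (C * m + k m) + ∑ l ∈ Finset.range q, (G (j + m * l) m + k m) := fun j hj => by
    have hjm : j ≤ m := (Finset.mem_range.1 hj).le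
    have h1 := h.mono 0 (show N ≤ j + m * q by omega)
    have h2 := h.le_add 0 j (m * q)
    have h3 := h.mul_le_sum m q j
    have h4 := h.le_mul 0 j
    have h5 := hk hjm
    have h6 : C * j ≤ C * m := by gcongr
    rw [zero_add] at h2
    linarith
  have := Finset.sum_le_sum key
  rw [Finset.sum_const, Finset.card_range, nsmul_eq_mul, Finset.sum_add_distrib, Finset.sum_const,
    Finset.card_range, nsmul_eq_mul, ← Finset.sum_range_mul_eq_sum_sum fun i => G i m + k m,
    Finset.sum_add_distrib, Finset.sum_const, Finset.card_range, nsmul_eq_mul] at this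
  push_cast at this
  exact this

end AlmostAdditive

section Counting

variable {A : Type*} {N : ℕ} {x y : ℕ → A}

theorem appears_seg_of_le {p ℓ ℓ' : ℕ} (h : ℓ' ≤ ℓ) (ha : appears N x (seg y p ℓ)) :
    appears N x (seg y p ℓ') := by
  obtain ⟨r, hr, hm⟩ := ha
  exact ⟨r, by omega, fun i => hm ⟨i, i.2.trans_le h⟩⟩

theorem le_zmLen {p ℓ : ℕ} (hp : p + ℓ ≤ N) (ha : appears N x (seg y p ℓ)) :
    ℓ ≤ zmLen N x y p :=
  le_max_of_le_right (le_csSup ⟨N, fun i hi => by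
    have := hi.1
    omega⟩ ⟨hp, ha⟩)

theorem le_zmLen_of_lt {p ℓ : ℕ} (ha : appears N x (seg y p ℓ)) (hp : p + zmLen N x y p < N) :
    ℓ ≤ zmLen N x y p := by
  by_cases h : p + ℓ ≤ N
  · exact le_zmLen h ha
  · have := le_zmLen (p := p) (ℓ := N - p) (by omega) (appears_seg_of_le (by omega) ha)
    omega

theorem zmPos_eq_sum (N : ℕ) (x y : ℕ → A) (j : ℕ) :
    zmPos N x y j = ∑ t ∈ Finset.range j, zmLen N x y (zmPos N x y t) := by
  induction j with
  | zero => rfl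
  | succ j ih => rw [Finset.sum_range_succ, ← ih, zmPos]

theorem zmPos_lt_of_lt_cN {j : ℕ} (hj : j < cN N x y) : zmPos N x y j < N :=
  not_le.1 fun h => Nat.notMem_of_lt_sInf hj h

/-- If every starting position of `y_1^N` carries a word of information content at least `L`
that appears in `x_1^N`, then the Ziv–Merhav parsing has few words. -/
theorem cN_mul_le {G : ℕ → ℕ → ℝ} {k : ℕ → ℝ} {C δ K L : ℝ} (h : AlmostAdditive G k C)
    (hk : ∀ n, k n ≤ δ * n + K) (hδ : 0 ≤ δ) (hK : 0 ≤ K) (hL : 0 ≤ L)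
    (hx : ∀ p < N, ∃ ℓ, L ≤ G p ℓ ∧ appears N x (seg y p ℓ)) :
    cN N x y * (L - K) ≤ G 0 N + δ * N + L := by
  have hNN : (0 : ℝ) ≤ δ * N := by positivity
  have hG := h.nonneg 0 N
  cases hc : cN N x y with
  | zero => simp; linarith
  | succ c =>
    have hlt : zmPos N x y c < N := zmPos_lt_of_lt_cN (by omega)
    have h1 := h.sum_le c (fun t => zmLen N x y (zmPos N x y t)) 0
    simp only [zero_add, ← zmPos_eq_sum] at h1
    have h2 : ∑ j ∈ Finset.range c, L ≤
        ∑ j ∈ Finset.range c, G (zmPos N x y j) (zmLen N x y (zmPos N x y j)) := by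
      refine Finset.sum_le_sum fun j hj => ?_
      have hj' : j + 1 < cN N x y := by rw [hc]; have := Finset.mem_range.1 hj; omega
      obtain ⟨ℓ, hℓ, ha⟩ := hx _ (zmPos_lt_of_lt_cN (Nat.lt_of_succ_lt hj'))
      exact hℓ.trans (h.mono _ (le_zmLen_of_lt ha (zmPos_lt_of_lt_cN hj')))
    have h3 : ∑ j ∈ Finset.range c, k (zmLen N x y (zmPos N x y j)) ≤
        δ * zmPos N x y c + c * K := by
      refine (Finset.sum_le_sum fun j _ => hk (zmLen N x y (zmPos N x y j))).trans (le_of_eq ?_)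
      rw [Finset.sum_add_distrib, ← Finset.mul_sum, ← Nat.cast_sum, ← zmPos_eq_sum]
      simp
    have h4 := h.mono 0 hlt.le
    have h5 : δ * zmPos N x y c ≤ δ * N := by gcongr
    rw [Finset.sum_const, Finset.card_range, nsmul_eq_mul] at h2
    push_cast
    linarith

end Counting

section Information

variable {A : Type*}

theorem iterate_shift (p : ℕ) (y : ℕ → A) : shift^[p] y = fun k => y (p + k) := by
  induction p generalizing y with
  | zero => simp
  | succ p ih =>
    rw [Function.iterate_succ_apply, ih]
    funext k
    simp only [shift]
    congr 1
    omega

theorem seg_iterate_shift (p i n : ℕ) (y : ℕ → A) : seg (shift^[p] y) i n = seg y (p + i) n := by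
  funext t
  simp [seg, iterate_shift, add_assoc]

theorem append_seg (y : ℕ → A) (p n m : ℕ) :
    Fin.append (seg y p n) (seg y (p + n) m) = seg y p (n + m) := by
  funext i
  refine Fin.addCases (fun i => ?_) (fun i => ?_) i
  · simp [seg]
  · simp [seg, add_assoc]

theorem cyl_seg_anti (y : ℕ → A) (p : ℕ) {n m : ℕ} (h : n ≤ m) :
    cyl (seg y p m) ⊆ cyl (seg y p n) :=
  fun _ hx i => hx ⟨i, i.2.trans_le h⟩

variable [MeasurableSpace A] {μ : Measure (ℕ → A)} {y : ℕ → A}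

theorem measure_cyl_seg_pos (hμ : MeasurePreserving shift μ μ) (hy : y ∈ suppSet μ) (p n : ℕ) :
    0 < μ (cyl (seg y p n)) := by
  refine (hy (p + n)).trans_le ((measure_mono fun x hx i => ?_).trans
    ((hμ.iterate p).measure_preimage_le _))
  have := hx ⟨p + i, by omega⟩
  simpa [seg, iterate_shift] using this

/-- The information content `-ln ℙ[y_{p+1}^{p+n}]`. -/
def info (μ : Measure (ℕ → A)) (y : ℕ → A) (p n : ℕ) : ℝ := -Real.log (wp μ (seg y p n))

theorem info_eq_iterate_shift (μ : Measure (ℕ → A)) (y : ℕ → A) (p n : ℕ) :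
    info μ y p n = info μ (shift^[p] y) 0 n := by
  rw [info, info, seg_iterate_shift, add_zero]

theorem exp_neg_info [IsProbabilityMeasure μ] {p n : ℕ} (h : 0 < μ (cyl (seg y p n))) :
    Real.exp (-info μ y p n) = wp μ (seg y p n) := by
  rw [info, neg_neg]
  exact Real.exp_log (ENNReal.toReal_pos h.ne' (measure_ne_top _ _))

theorem mul_le_info [IsProbabilityMeasure μ] (hμ : MeasurePreserving shift μ μ) {γ : ℝ}
    (hγ : CondFE μ γ) (hy : y ∈ suppSet μ) : ∀ᶠ n : ℕ in atTop, ∀ p, -γ * n ≤ info μ y p n := by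
  filter_upwards [hγ.2] with n hn p
  have hpos := measure_cyl_seg_pos hμ hy p n
  have := Real.log_le_log (ENNReal.toReal_pos hpos.ne' (measure_ne_top _ _)) (hn _ hpos)
  rw [Real.log_exp] at this
  simp only [info, wp]
  linarith

variable [Fintype A]

/-- A linear growth rate for the information content. -/
def infoBound (μ : Measure (ℕ → A)) (k : ℕ → ℝ) : ℝ :=
  k 1 + ∑ a : Fin 1 → A, |Real.log (wp μ a)|

theorem ae_mem_suppSet (μ : Measure (ℕ → A)) : ∀ᵐ y ∂μ, y ∈ suppSet μ := by
  refine ae_all_iff.2 fun n => ?_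
  have : {y : ℕ → A | ¬ 0 < μ (cyl (seg y 0 n))} ⊆
      ⋃ a : {a : Fin n → A // μ (cyl a) = 0}, cyl a.1 := fun y hy =>
    Set.mem_iUnion.2 ⟨⟨seg y 0 n, le_zero_iff.1 (not_lt.1 hy)⟩, fun i => by simp [seg]⟩
  exact measure_mono_null this (measure_iUnion_null fun a => a.2)

variable [IsProbabilityMeasure μ] {k : ℕ → ℝ}

theorem almostAdditive_info (hμ : MeasurePreserving shift μ μ) (hk : CondID μ k)
    (hy : y ∈ suppSet μ) : AlmostAdditive (info μ y) k (infoBound μ k) := by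
  have hpos := measure_cyl_seg_pos hμ hy
  have hwp : ∀ p n, 0 < wp μ (seg y p n) := fun p n =>
    ENNReal.toReal_pos (hpos p n).ne' (measure_ne_top _ _)
  have hzero : ∀ p, info μ y p 0 = 0 := fun p => by
    have : cyl (seg y p 0) = Set.univ := Set.eq_univ_of_forall fun x i => i.elim0
    simp [info, wp, this]
  have hle : ∀ p n m, info μ y p (n + m) ≤ info μ y p n + info μ y (p + n) m + k n := by
    intro p n m
    have h := (hk.2.2 n m _ _ (hpos p n) (hpos (p + n) m)).2 (by rw [append_seg]; exact hpos _ _)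
    rw [append_seg] at h
    have := Real.log_le_log (mul_pos (Real.exp_pos _) (mul_pos (hwp _ _) (hwp _ _))) h
    rw [Real.log_mul (Real.exp_pos _).ne' (mul_pos (hwp _ _) (hwp _ _)).ne', Real.log_exp,
      Real.log_mul (hwp _ _).ne' (hwp _ _).ne'] at this
    simp only [info]
    linarith
  have hge : ∀ p n m, info μ y p n + info μ y (p + n) m ≤ info μ y p (n + m) + k n := by
    intro p n m
    have h := (hk.2.2 n m _ _ (hpos p n) (hpos (p + n) m)).1
    rw [append_seg] at h
    have := Real.log_le_log (hwp _ _) h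
    rw [Real.log_mul (Real.exp_pos _).ne' (mul_pos (hwp _ _) (hwp _ _)).ne', Real.log_exp,
      Real.log_mul (hwp _ _).ne' (hwp _ _).ne'] at this
    simp only [info]
    linarith
  refine ⟨hzero, fun p n m hnm => ?_, hle, hge, fun p n => ?_⟩
  · exact neg_le_neg (Real.log_le_log (hwp _ _)
      (ENNReal.toReal_mono (measure_ne_top _ _) (measure_mono (cyl_seg_anti y p hnm))))
  · induction n generalizing p with
    | zero => simp [hzero]
    | succ n ih =>
      have h1 := hle p 1 n
      have h2 := ih (p + 1)
      have h3 : |Real.log (wp μ (seg y p 1))| ≤ ∑ a : Fin 1 → A, |Real.log (wp μ a)| :=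
        Finset.single_le_sum (f := fun a : Fin 1 → A => |Real.log (wp μ a)|)
          (fun _ _ => abs_nonneg _) (Finset.mem_univ _)
      have h4 : info μ y p 1 ≤ |Real.log (wp μ (seg y p 1))| := neg_le_abs _
      rw [add_comm n 1]
      push_cast
      rw [infoBound] at *
      linarith

end Information

section NullMeasurability

variable {A : Type*} [MeasurableSpace A]

theorem comp_mem_iff_of_measurableSet {φ : A → A}
    (hφ : ∀ U : Set A, MeasurableSet U → φ ⁻¹' U = U) {S : Set (ℕ → A)} (hS : MeasurableSet S)
    (x : ℕ → A) : φ ∘ x ∈ S ↔ x ∈ S := by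
  have hle : (MeasurableSpace.pi : MeasurableSpace (ℕ → A)) ≤
      @MeasurableSpace.invariants (ℕ → A) ⊤ fun x => φ ∘ x := by
    refine iSup_le fun i => ?_
    rintro _ ⟨U, hU, rfl⟩
    refine ⟨trivial, ?_⟩
    ext x
    exact Set.ext_iff.1 (hφ U hU) (x i)
  exact Set.ext_iff.1 (hle S hS).2 x

/-- A letter that is not measurable can be avoided without leaving any measurable set. -/
theorem exists_avoiding_map [Countable A] {c : A} (hc : ¬ MeasurableSet {c}) :
    ∃ φ : A → A, (∀ U : Set A, MeasurableSet U → φ ⁻¹' U = U) ∧ ∀ a, φ a ≠ c := by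
  obtain ⟨c', hc', hne⟩ : ∃ c' ∈ measurableAtom c, c' ≠ c := by
    by_contra! h
    refine hc ?_
    rw [← Set.eq_singleton_iff_unique_mem.2 ⟨mem_measurableAtom_self c, h⟩]
    exact MeasurableSet.measurableAtom_of_countable c
  have hiff : ∀ U : Set A, MeasurableSet U → (c' ∈ U ↔ c ∈ U) := fun U hU =>
    ⟨fun h => by_contra fun hcU => mem_of_mem_measurableAtom hc' hU.compl hcU h,
      fun h => mem_of_mem_measurableAtom hc' hU h⟩
  refine ⟨fun a => if a = c then c' else a, fun U hU => ?_, fun a => ?_⟩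
  · ext a
    by_cases ha : a = c
    · simp [ha, hiff U hU]
    · simp [ha]
  · by_cases ha : a = c <;> simp [ha, hne]

theorem measure_le_W_eq_one [Countable A] (μ : Measure (ℕ → A)) [IsProbabilityMeasure μ] {ℓ : ℕ}
    {w : Fin ℓ → A} {i : Fin ℓ} (hw : ¬ MeasurableSet {w i}) (r : ℕ) :
    μ {x | (r : ℕ∞) ≤ W w x} = 1 := by
  obtain ⟨φ, hφ, hφw⟩ := exists_avoiding_map hw
  have huniv : toMeasurable μ {x | (r : ℕ∞) ≤ W w x} = Set.univ := by
    refine Set.eq_univ_of_forall fun x => ?_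
    rw [← comp_mem_iff_of_measurableSet hφ (measurableSet_toMeasurable _ _)]
    refine subset_toMeasurable _ _ (show (r : ℕ∞) ≤ W w (φ ∘ x) from le_sInf ?_)
    rintro _ ⟨n, rfl, -, hn⟩
    exact absurd (hn i) (hφw _)
  rw [← measure_toMeasurable, huniv, measure_univ]

theorem measure_le_W_lt_one {μ : Measure (ℕ → A)} {k τ : ℕ → ℝ} (h : CondKB μ k τ) :
    ∀ᶠ ℓ in atTop, ∀ w : Fin ℓ → A, 0 < wp μ w → ∃ r : ℕ,
      (μ {x | (r : ℕ∞) ≤ W w x}).toReal < 1 := by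
  filter_upwards [h.2.1.def (show (0 : ℝ) < 1 / 2 by norm_num), eventually_gt_atTop 0]
    with ℓ hτ hℓ w hw
  have hℓ' : (0 : ℝ) < ℓ := by exact_mod_cast hℓ
  have hpos : 0 < ℓ + τ ℓ := by
    rw [Real.norm_eq_abs, Real.norm_eq_abs, abs_of_pos hℓ'] at hτ
    linarith [neg_abs_le (τ ℓ)]
  obtain ⟨r, hr⟩ := exists_nat_ge (ℓ + τ ℓ + 1)
  refine ⟨r, (h.2.2 ℓ w r).trans_lt (Real.exp_lt_one_iff.2 (neg_lt_zero.2 ?_))⟩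
  have hfl : 1 ≤ ⌊((r : ℝ) - 1) / ((ℓ : ℝ) + τ ℓ)⌋ := by
    rw [Int.le_floor, le_div_iff₀ hpos]
    push_cast
    linarith
  have : (0 : ℝ) < ⌊((r : ℝ) - 1) / ((ℓ : ℝ) + τ ℓ)⌋ := by exact_mod_cast hfl
  positivity

variable [Fintype A] {μ ν : Measure (ℕ → A)} [IsProbabilityMeasure μ]

theorem measurableSet_singleton_of_mem_suppSet {k τ : ℕ → ℝ} (h : CondKB μ k τ) {y : ℕ → A}
    (hy : y ∈ suppSet μ) : MeasurableSet {y 0} := by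
  by_contra hc
  obtain ⟨ℓ, hℓ, hℓ0⟩ := ((measure_le_W_lt_one h).and (eventually_gt_atTop 0)).exists
  obtain ⟨r, hr⟩ := hℓ (seg y 0 ℓ) (ENNReal.toReal_pos (hy ℓ).ne' (measure_ne_top _ _))
  rw [measure_le_W_eq_one μ (i := ⟨0, hℓ0⟩) (by simpa [seg] using hc)] at hr
  simp at hr

theorem nullMeasurableSet_letter {k τ : ℕ → ℝ} (h : CondKB μ k τ)
    (hν : MeasurePreserving shift ν ν) (hsupp : suppSet ν ⊆ suppSet μ) (i : ℕ) (c : A) :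
    NullMeasurableSet {x : ℕ → A | x i = c} ν := by
  by_cases hc : MeasurableSet {c}
  · exact ((measurable_pi_apply i : Measurable fun x : ℕ → A => x i) hc).nullMeasurableSet
  · have h0 : ν {x | x 0 = c} = 0 := by
      refine measure_mono_null (fun x hx (hxs : x ∈ suppSet ν) => hc ?_) (ae_mem_suppSet ν)
      have := measurableSet_singleton_of_mem_suppSet h (hsupp hxs)
      rwa [show x 0 = c from hx] at this
    have := (hν.iterate i).quasiMeasurePreserving.preimage_null h0
    refine NullMeasurableSet.of_null ?_
    simpa [iterate_shift] using this

theorem nullMeasurableSet_cyl {k τ : ℕ → ℝ} (h : CondKB μ k τ)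
    (hν : MeasurePreserving shift ν ν) (hsupp : suppSet ν ⊆ suppSet μ) {n : ℕ} (a : Fin n → A) :
    NullMeasurableSet (cyl a) ν := by
  rw [show cyl a = ⋂ i : Fin n, {x | x i = a i} by ext; simp [cyl]]
  exact NullMeasurableSet.iInter fun i => nullMeasurableSet_letter h hν hsupp _ _

end NullMeasurability

section Rates

theorem eventually_le_mul_of_block_bound {b : ℕ → ℝ} {m : ℕ} {K s ε : ℝ} (hm : 1 ≤ m)
    (hs : 0 ≤ s) (hε : 0 < ε) (h : ∀ q N : ℕ, N ≤ m * q → m * b N ≤ K + m * q * s) :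
    ∀ᶠ N : ℕ in atTop, b N ≤ (s / m + ε) * N := by
  have hm' : (0 : ℝ) < m := by exact_mod_cast hm
  filter_upwards [(tendsto_natCast_atTop_atTop (R := ℝ)).eventually_ge_atTop
    ((K + m * s) / m / ε)] with N hN
  rw [div_le_iff₀ hε] at hN
  have h1 := h (N / m + 1) N (Nat.lt_mul_div_succ N hm).le
  have h2 : (m : ℝ) * ((N / m + 1 : ℕ) : ℝ) ≤ N + m := by
    have : m * (N / m + 1) ≤ N + m := by
      rw [mul_add, mul_one]
      gcongr
      exact Nat.mul_div_le N m
    exact_mod_cast this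
  have h3 := mul_le_mul_of_nonneg_right h2 hs
  have h4 : b N ≤ (K + (N + m) * s) / m := by
    rw [le_div_iff₀ hm']
    linarith
  calc b N ≤ (K + (N + m) * s) / m := h4
    _ = s / m * N + (K + m * s) / m := by ring
    _ ≤ _ := by linarith

theorem exists_tendsto_div_of_block_bound {a k : ℕ → ℝ} {C : ℝ} (ha : ∀ n, 0 ≤ a n)
    (haC : ∀ n, a n ≤ C * n) (hk : k =o[atTop] fun n => (n : ℝ)) (hk0 : ∀ n, 0 ≤ k n)
    (h : ∀ m q N : ℕ, N ≤ m * q → m * a N ≤ m * (C * m + k m) + m * q * (a m + k m)) :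
    ∃ c, 0 ≤ c ∧ Tendsto (fun n => a n / n) atTop (nhds c) := by
  have hkn : Tendsto (fun n => k n / n) atTop (nhds 0) := hk.tendsto_div_nhds_zero
  have hbelow : ∀ n : ℕ, 0 ≤ a n / n := fun n => div_nonneg (ha n) n.cast_nonneg
  have hC : 0 ≤ C := by simpa using (ha 1).trans (haC 1)
  have habove : ∀ n : ℕ, a n / n ≤ C := fun n => div_le_of_le_mul₀ n.cast_nonneg hC (haC n)
  have hbb : IsBoundedUnder (· ≥ ·) atTop fun n : ℕ => a n / n :=
    isBoundedUnder_of ⟨0, hbelow⟩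
  have hba : IsBoundedUnder (· ≤ ·) atTop fun n : ℕ => a n / n :=
    isBoundedUnder_of ⟨C, habove⟩
  refine ⟨liminf (fun n : ℕ => a n / n) atTop,
    le_liminf_of_le hba.isCoboundedUnder_ge (Eventually.of_forall hbelow),
    tendsto_of_le_liminf_of_limsup_le le_rfl ?_ hba hbb⟩
  refine le_of_forall_pos_le_add fun ε hε => ?_
  have hfreq : ∃ᶠ n : ℕ in atTop, a n / n < liminf (fun n : ℕ => a n / n) atTop + ε / 3 :=
    frequently_lt_of_liminf_lt hba.isCoboundedUnder_ge (by linarith)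
  obtain ⟨m, hm1, hm2, hm3⟩ := (hfreq.and_eventually
    ((hkn.eventually_lt_const (show 0 < ε / 3 by linarith)).and (eventually_ge_atTop 1))).exists
  refine limsup_le_of_le hbb.isCoboundedUnder_le ?_
  filter_upwards [eventually_le_mul_of_block_bound hm3 (add_nonneg (ha m) (hk0 m))
    (show 0 < ε / 3 by linarith) (h m), eventually_gt_atTop 0] with N hN hN0
  rw [div_le_iff₀ (by exact_mod_cast hN0)]
  refine hN.trans (mul_le_mul_of_nonneg_right ?_ N.cast_nonneg)
  rw [add_div]
  linarith

end Rates

section Mean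

variable {A : Type*} [MeasurableSpace A] [Fintype A] {μ ν : Measure (ℕ → A)}

theorem info_zero_eq_sum (μ : Measure (ℕ → A)) (n : ℕ) (y : ℕ → A) :
    info μ y 0 n = ∑ a : Fin n → A, (cyl a).indicator (fun _ => -Real.log (wp μ a)) y := by
  rw [Finset.sum_eq_single (seg y 0 n)]
  · rw [Set.indicator_of_mem (show y ∈ cyl (seg y 0 n) from fun i => by simp [seg])]
    rfl
  · refine fun a _ ha => Set.indicator_of_notMem (fun hy => ha ?_) _
    funext i
    simpa [seg] using (hy i).symm
  · simp

variable [IsProbabilityMeasure ν]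

theorem integrable_info (hcyl : ∀ (n : ℕ) (a : Fin n → A), NullMeasurableSet (cyl a) ν) (n : ℕ) :
    Integrable (fun y => info μ y 0 n) ν := by
  simp only [info_zero_eq_sum]
  exact integrable_finsetSum _ fun a _ => (integrable_const _).indicator₀ (hcyl n a)

theorem hcSeq_eq_integral_div
    (hcyl : ∀ (n : ℕ) (a : Fin n → A), NullMeasurableSet (cyl a) ν) (n : ℕ) :
    hcSeq μ ν n = (∫ y, info μ y 0 n ∂ν) / n := by
  simp only [info_zero_eq_sum]
  rw [integral_finsetSum _ fun a _ => (integrable_const _).indicator₀ (hcyl n a), hcSeq]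
  have : ∀ a : Fin n → A, ∫ y, (cyl a).indicator (fun _ => -Real.log (wp μ a)) y ∂ν =
      -(wp ν a * Real.log (wp μ a)) := fun a => by
    rw [integral_indicator₀ (hcyl n a), setIntegral_const, smul_eq_mul, mul_neg]
    rfl
  simp only [this, Finset.sum_neg_distrib]
  ring

variable [IsProbabilityMeasure μ] {k : ℕ → ℝ}

theorem integral_info_block_bound (hμ : MeasurePreserving shift μ μ) (hk : CondID μ k)
    (hν : MeasurePreserving shift ν ν) (hsupp : suppSet ν ⊆ suppSet μ)
    (hcyl : ∀ (n : ℕ) (a : Fin n → A), NullMeasurableSet (cyl a) ν) {m q N : ℕ}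
    (hN : N ≤ m * q) :
    m * ∫ y, info μ y 0 N ∂ν ≤
      m * (infoBound μ k * m + k m) + m * q * ((∫ y, info μ y 0 m ∂ν) + k m) := by
  have hint := integrable_info (μ := μ) hcyl
  have hshift : ∀ i, ∫ y, info μ y i m ∂ν = ∫ y, info μ y 0 m ∂ν := fun i => by
    have hi := hν.iterate i
    simp only [info_eq_iterate_shift μ _ i m]
    rw [← integral_map (f := fun y => info μ y 0 m) hi.aemeasurable
      (by rw [hi.map_eq]; exact (hint m).aestronglyMeasurable), hi.map_eq]
  have hinti : ∀ i, Integrable (fun y => info μ y i m) ν := fun i => by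
    simp only [info_eq_iterate_shift μ _ i m]
    exact (hν.iterate i).integrable_comp_of_integrable (hint m)
  have hsum : Integrable (fun y => ∑ i ∈ Finset.range (m * q), info μ y i m) ν :=
    integrable_finsetSum _ fun i _ => hinti i
  have key := integral_mono_ae ((hint N).const_mul (m : ℝ))
    ((integrable_const ((m : ℝ) * (infoBound μ k * m + k m))).add
      (hsum.add (integrable_const ((m : ℝ) * q * k m)))) (by
    filter_upwards [ae_mem_suppSet ν] with y hy
    exact (almostAdditive_info hμ hk (hsupp hy)).mul_le_birkhoff hk.1 hN)
  rw [integral_const_mul] at key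
  refine key.trans (le_of_eq ?_)
  rw [integral_add' (integrable_const _) (hsum.add (integrable_const _)),
    integral_add' hsum (integrable_const _), integral_finsetSum _ fun i _ => hinti i]
  simp only [hshift, integral_const, Finset.sum_const, Finset.card_range, nsmul_eq_mul, smul_eq_mul,
    probReal_univ]
  push_cast
  ring

theorem exists_tendsto_hcSeq (hμ : MeasurePreserving shift μ μ) (hk : CondID μ k)
    (hν : MeasurePreserving shift ν ν) (hsupp : suppSet ν ⊆ suppSet μ)
    (hcyl : ∀ (n : ℕ) (a : Fin n → A), NullMeasurableSet (cyl a) ν) :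
    ∃ h : ℝ, 0 ≤ h ∧ Tendsto (fun n => hcSeq μ ν n) atTop (nhds h) := by
  have hadd : ∀ᵐ y ∂ν, AlmostAdditive (info μ y) k (infoBound μ k) := by
    filter_upwards [ae_mem_suppSet ν] with y hy
    exact almostAdditive_info hμ hk (hsupp hy)
  obtain ⟨y, hy⟩ := hadd.exists
  simp only [hcSeq_eq_integral_div hcyl]
  refine exists_tendsto_div_of_block_bound (C := infoBound μ k) (fun n => ?_) (fun n => ?_) hk.2.1
    hy.error_nonneg fun m q N hN => integral_info_block_bound hμ hk hν hsupp hcyl hN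
  · exact integral_nonneg_of_ae (hadd.mono fun y hy => hy.nonneg 0 n)
  · refine (integral_mono_ae (integrable_info hcyl n) (integrable_const _)
      (hadd.mono fun y hy => hy.le_mul 0 n)).trans ?_
    simp

theorem ae_eventually_info_le (hμ : MeasurePreserving shift μ μ) (hk : CondID μ k)
    (hν : Ergodic shift ν) (hsupp : suppSet ν ⊆ suppSet μ)
    (hcyl : ∀ (n : ℕ) (a : Fin n → A), NullMeasurableSet (cyl a) ν) {h ε : ℝ}
    (hh : Tendsto (fun n => hcSeq μ ν n) atTop (nhds h)) (hε : 0 < ε) :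
    ∀ᵐ y ∂ν, ∀ᶠ N : ℕ in atTop, info μ y 0 N ≤ (h + ε) * N := by
  have hkn : Tendsto (fun n => k n / n) atTop (nhds 0) := hk.2.1.tendsto_div_nhds_zero
  obtain ⟨m, hm1, hm2, hm3⟩ := ((hh.eventually_lt_const (show h < h + ε / 4 by linarith)).and
    ((hkn.eventually_lt_const (show 0 < ε / 4 by linarith)).and (eventually_ge_atTop 1))).exists
  have hm : (1 : ℝ) ≤ m := by exact_mod_cast hm3
  have hint := integrable_info (μ := μ) hcyl m
  rw [hcSeq_eq_integral_div hcyl] at hm1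
  set a := ∫ y, info μ y 0 m ∂ν
  have hbdd := hν.ae_bddAbove_birkhoffSum (g := fun y => info μ y 0 m - (a + ε / 4))
    (hint.sub (integrable_const _)) (by
      rw [integral_sub hint (integrable_const _)]
      simp only [integral_const, probReal_univ, smul_eq_mul]
      linarith)
  filter_upwards [hbdd, ae_mem_suppSet ν] with y ⟨K, hK⟩ hy
  have hadd := almostAdditive_info hμ hk (hsupp hy)
  have ha : 0 ≤ a := integral_nonneg_of_ae <| by
    filter_upwards [ae_mem_suppSet ν] with y hy
    exact (almostAdditive_info hμ hk (hsupp hy)).nonneg 0 m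
  have hkm := hadd.error_nonneg m
  refine (eventually_le_mul_of_block_bound (K := m * (infoBound μ k * m + k m) + K)
    (s := a + ε / 4 + k m) (ε := ε / 4) hm3 (by linarith) (by linarith)
    fun q N hN => ?_).mono fun N hN => hN.trans
      (mul_le_mul_of_nonneg_right ?_ N.cast_nonneg)
  · have h1 := hadd.mul_le_birkhoff hk.1 hN
    have h2 : birkhoffSum shift (fun y => info μ y 0 m - (a + ε / 4)) (m * q) y ≤ K :=
      hK ⟨_, rfl⟩
    simp only [birkhoffSum, ← info_eq_iterate_shift, Finset.sum_sub_distrib, Finset.sum_const,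
      Finset.card_range, nsmul_eq_mul] at h2
    push_cast at h2
    linarith
  · have : ε / 4 / m ≤ ε / 4 := div_le_self (by linarith) hm
    rw [add_div, add_div]
    linarith

end Mean

section WaitingTimes

theorem exists_le_mul_add_of_isLittleO {k : ℕ → ℝ} (hk : k =o[atTop] fun n => (n : ℝ)) {δ : ℝ}
    (hδ : 0 < δ) : ∃ K, 0 ≤ K ∧ ∀ n, k n ≤ δ * n + K := by
  obtain ⟨n₀, hn₀⟩ := eventually_atTop.1 (hk.def hδ)
  refine ⟨∑ i ∈ Finset.range n₀, |k i|, Finset.sum_nonneg fun _ _ => abs_nonneg _, fun n => ?_⟩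
  have hn : (0 : ℝ) ≤ δ * n := by positivity
  rcases lt_or_ge n n₀ with h | h
  · have := Finset.single_le_sum (f := fun i => |k i|) (fun _ _ => abs_nonneg _)
      (Finset.mem_range.2 h)
    linarith [le_abs_self (k n)]
  · have h1 := hn₀ n h
    rw [Real.norm_eq_abs, Real.norm_eq_abs, Nat.abs_cast] at h1
    have : 0 ≤ ∑ i ∈ Finset.range n₀, |k i| := Finset.sum_nonneg fun _ _ => abs_nonneg _
    linarith [le_abs_self (k n)]

variable {G : ℕ → ℕ → ℝ} {k : ℕ → ℝ} {C g : ℝ}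

/-- Words whose information content first exceeds `L` have length `O(L)`. -/
theorem AlmostAdditive.exists_first_passage (h : AlmostAdditive G k C) (hg : 0 < g) {n₀ : ℕ}
    (hFE : ∀ n ≥ n₀, ∀ p, g * n ≤ G p n) {L : ℝ} (hL : 0 < L) (p : ℕ) :
    ∃ ℓ : ℕ, L ≤ G p (ℓ + 1) ∧ G p ℓ < L ∧ (ℓ : ℝ) ≤ n₀ + L / g := by
  have hex : ∃ n, L ≤ G p n := by
    obtain ⟨n, hn⟩ := exists_nat_ge (L / g)
    refine ⟨max n n₀, le_trans ?_ (hFE _ (le_max_right _ _) p)⟩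
    rw [div_le_iff₀' hg] at hn
    refine hn.trans ?_
    gcongr
    exact le_max_left _ _
  have hne : Nat.find hex ≠ 0 := fun h0 => by
    have := Nat.find_spec hex
    rw [h0, h.zero] at this
    linarith
  obtain ⟨ℓ, hℓ⟩ := Nat.exists_eq_succ_of_ne_zero hne
  have hspec := Nat.find_spec hex
  rw [hℓ] at hspec
  have hlt : G p ℓ < L := not_le.1 (Nat.find_min hex (by omega))
  refine ⟨ℓ, hspec, hlt, ?_⟩
  have hLg : 0 < L / g := div_pos hL hg
  rcases lt_or_ge ℓ n₀ with hn | hn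
  · have : (ℓ : ℝ) ≤ n₀ := by exact_mod_cast hn.le
    linarith
  · have h1 : (ℓ : ℝ) ≤ L / g := by
      rw [le_div_iff₀' hg]
      exact (hFE ℓ hn p).trans hlt.le
    have : (0 : ℝ) ≤ n₀ := n₀.cast_nonneg
    linarith

theorem AlmostAdditive.eventually_exists_length (h : AlmostAdditive G k C)
    (hk : k =o[atTop] fun n => (n : ℝ)) {κ τ : ℕ → ℝ} (hκ : κ =o[atTop] fun n => (n : ℝ))
    (hτ : τ =o[atTop] fun n => (n : ℝ)) (hg : 0 < g) (hFE : ∀ᶠ n : ℕ in atTop, ∀ p, g * n ≤ G p n)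
    {ε : ℝ} (hε : 0 < ε) (hε1 : ε < 1) :
    ∀ᶠ N : ℕ in atTop, ∀ p, ∃ ℓ ≤ N, (1 - ε) * Real.log N ≤ G p ℓ ∧
      3 * Real.log N ≤
        Real.exp (-κ ℓ) * Real.exp (-G p ℓ) * ⌊((N : ℝ) - ℓ + 1) / (ℓ + τ ℓ)⌋ := by
  obtain ⟨n₀, hn₀⟩ := eventually_atTop.1 hFE
  obtain ⟨n₁, hn₁⟩ := eventually_atTop.1 (hτ.def (show (0 : ℝ) < 1 / 2 by norm_num))
  set D : ℝ := 2 / g with hD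
  have hDpos : 0 < D := by positivity
  have hδ : 0 < ε / (4 * D) := by positivity
  obtain ⟨K₁, hK₁0, hK₁⟩ := exists_le_mul_add_of_isLittleO hk hδ
  obtain ⟨K₂, hK₂0, hK₂⟩ := exists_le_mul_add_of_isLittleO hκ hδ
  set K := K₁ + K₂ + C with hK
  have hlog : Tendsto (fun N : ℕ => Real.log N) atTop atTop :=
    Real.tendsto_log_atTop.comp tendsto_natCast_atTop_atTop
  have hexp : ∀ᶠ L : ℝ in atTop, 24 * D * Real.exp K * L ^ 2 ≤ Real.exp (ε / 2 * L) := by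
    have hc : 0 < (24 * D * Real.exp K)⁻¹ := by positivity
    filter_upwards [(isLittleO_pow_exp_pos_mul_atTop 2 (half_pos hε)).def hc] with L hL
    rw [Real.norm_of_nonneg (by positivity), Real.norm_of_nonneg (by positivity),
      inv_mul_eq_div, le_div_iff₀' (by positivity)] at hL
    exact hL
  have hexp' : ∀ᶠ L : ℝ in atTop, 8 * D * L ≤ Real.exp L := by
    have hc : 0 < (8 * D)⁻¹ := by positivity
    filter_upwards [(isLittleO_pow_exp_pos_mul_atTop 1 one_pos).def hc, eventually_ge_atTop 0]
      with L hL hL0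
    rw [pow_one, one_mul, Real.norm_of_nonneg hL0, Real.norm_of_nonneg (by positivity),
      inv_mul_eq_div, le_div_iff₀' (by positivity)] at hL
    exact hL
  filter_upwards [hlog.eventually hexp, hlog.eventually hexp',
    hlog.eventually (eventually_gt_atTop 0),
    hlog.eventually (eventually_ge_atTop (g * (n₀ + 1))),
    hlog.eventually (eventually_gt_atTop (C * n₁ / (1 - ε))), eventually_gt_atTop 0]
    with N h1 h2 h3 h4 h5 hN p
  have hNexp : Real.exp (Real.log N) = N := Real.exp_log (by exact_mod_cast hN)
  set L := Real.log N with hL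
  rw [hNexp] at h2
  have hε' : 0 < 1 - ε := by linarith
  obtain ⟨ℓ, hℓ1, hℓ2, hℓ3⟩ := h.exists_first_passage hg hn₀ (mul_pos hε' h3) p
  have hℓD : ((ℓ + 1 : ℕ) : ℝ) ≤ D * L := by
    have e1 : (n₀ : ℝ) + 1 ≤ L / g := by rwa [le_div_iff₀' hg]
    have e2 : (1 - ε) * L / g ≤ L / g := by
      gcongr
      nlinarith
    have e3 : D * L = L / g + L / g := by rw [hD]; ring
    push_cast
    linarith
  have hℓn₁ : n₁ ≤ ℓ + 1 := by
    by_contra! hlt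
    rw [div_lt_iff₀' hε'] at h5
    have e1 := h.le_mul p (ℓ + 1)
    have e2 : C * ((ℓ + 1 : ℕ) : ℝ) ≤ C * n₁ :=
      mul_le_mul_of_nonneg_left (by exact_mod_cast hlt.le) h.const_nonneg
    linarith
  have hℓpos : (0 : ℝ) < ((ℓ + 1 : ℕ) : ℝ) := by positivity
  have hτℓ := hn₁ _ hℓn₁
  rw [Real.norm_eq_abs, Real.norm_eq_abs, Nat.abs_cast] at hτℓ
  have hden : 0 < ((ℓ + 1 : ℕ) : ℝ) + τ (ℓ + 1) := by linarith [neg_abs_le (τ (ℓ + 1))]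
  have hden' : ((ℓ + 1 : ℕ) : ℝ) + τ (ℓ + 1) ≤ 2 * (D * L) := by linarith [le_abs_self (τ (ℓ + 1))]
  have hfloor : (N : ℝ) / (8 * D * L) ≤
      ⌊((N : ℝ) - ((ℓ + 1 : ℕ) : ℝ) + 1) / (((ℓ + 1 : ℕ) : ℝ) + τ (ℓ + 1))⌋ := by
    have hDL : 0 < D * L := by positivity
    have e1 : (N : ℝ) / (4 * (D * L)) ≤
        ((N : ℝ) - ((ℓ + 1 : ℕ) : ℝ) + 1) / (((ℓ + 1 : ℕ) : ℝ) + τ (ℓ + 1)) := by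
      rw [show (N : ℝ) / (4 * (D * L)) = (N / 2) / (2 * (D * L)) by ring]
      exact div_le_div₀ (by linarith) (by linarith) hden hden'
    have e2 : 1 ≤ (N : ℝ) / (8 * D * L) := by
      rw [le_div_iff₀ (by positivity)]
      linarith
    have e3 : (N : ℝ) / (4 * (D * L)) = N / (8 * D * L) + N / (8 * D * L) := by
      field_simp
      norm_num
    linarith [Int.sub_one_lt_floor
      (((N : ℝ) - ((ℓ + 1 : ℕ) : ℝ) + 1) / (((ℓ + 1 : ℕ) : ℝ) + τ (ℓ + 1)))]
  refine ⟨ℓ + 1, ?_, hℓ1, ?_⟩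
  · have : ((ℓ + 1 : ℕ) : ℝ) ≤ N := by nlinarith [mul_pos hDpos h3]
    exact_mod_cast this
  · have hδD : ε / (4 * D) * (D * L) = ε / 4 * L := by field_simp
    have e1 : κ (ℓ + 1) ≤ ε / 4 * L + K₂ := by
      refine (hK₂ _).trans ?_
      rw [← hδD]
      gcongr
    have e2 : G p (ℓ + 1) ≤ (1 - ε) * L + (ε / 4 * L + K₁) + C := by
      have f1 := h.le_add p ℓ 1
      have f2 := h.le_mul (p + ℓ) 1
      have f3 : k ℓ ≤ ε / 4 * L + K₁ := by
        refine (hK₁ _).trans ?_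
        rw [← hδD]
        gcongr
        refine le_trans ?_ hℓD
        push_cast
        linarith
      rw [Nat.cast_one, mul_one] at f2
      linarith
    have e3 : Real.exp (ε / 2 * L) / (Real.exp K * N) ≤
        Real.exp (-κ (ℓ + 1)) * Real.exp (-G p (ℓ + 1)) := by
      rw [← hNexp, ← Real.exp_add, ← Real.exp_sub, ← Real.exp_add]
      gcongr
      linarith
    calc 3 * L = 24 * D * Real.exp K * L ^ 2 / (Real.exp K * N) * (N / (8 * D * L)) := by
          have : (N : ℝ) ≠ 0 := by positivity
          field_simp
          norm_num
      _ ≤ Real.exp (ε / 2 * L) / (Real.exp K * N) * (N / (8 * D * L)) := by gcongr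
      _ ≤ _ := by gcongr

theorem appears_of_W_lt {A : Type*} {x : ℕ → A} {N ℓ : ℕ} {w : Fin ℓ → A} (hℓ : ℓ ≤ N)
    (hW : W w x < ((N + 2 - ℓ : ℕ) : ℕ∞)) : appears N x w := by
  obtain ⟨_, ⟨n, rfl, hn, hm⟩, hlt⟩ := sInf_lt_iff.1 hW
  have : n < N + 2 - ℓ := by exact_mod_cast hlt
  exact ⟨n - 1, by omega, hm⟩

variable {A : Type*} [MeasurableSpace A] [Fintype A] {μ : Measure (ℕ → A)}
  [IsProbabilityMeasure μ]

theorem ae_eventually_appears (hμ : MeasurePreserving shift μ μ) (hk : CondID μ k)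
    {γ : ℝ} (hγ : CondFE μ γ) {κ τ : ℕ → ℝ} (hKB : CondKB μ κ τ) {y : ℕ → A}
    (hy : y ∈ suppSet μ) {ε : ℝ} (hε : 0 < ε) (hε1 : ε < 1) :
    ∀ᵐ x ∂μ, ∀ᶠ N : ℕ in atTop, ∀ p < N, ∃ ℓ, (1 - ε) * Real.log N ≤ info μ y p ℓ ∧
      appears N x (seg y p ℓ) := by
  have hlen := (almostAdditive_info hμ hk hy).eventually_exists_length hk.2.1 hKB.1 hKB.2.1
    (neg_pos.2 hγ.1) (mul_le_info hμ hγ hy) hε hε1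
  obtain ⟨N₀, hN₀⟩ := eventually_atTop.1 (hlen.and (eventually_gt_atTop 0))
  choose! ℓ hℓ using fun N hN => (hN₀ N hN).1
  set S : ℕ → Set (ℕ → A) := fun N =>
    {x | N₀ ≤ N ∧ ∃ p < N, ((N + 2 - ℓ N p : ℕ) : ℕ∞) ≤ W (seg y p (ℓ N p)) x} with hS
  have hSle : ∀ N, μ (S N) ≤ ENNReal.ofReal (1 / (N : ℝ) ^ 2) := by
    intro N
    by_cases hN : N₀ ≤ N
    swap
    · simp [hS, hN]
    have hNpos : (0 : ℝ) < N := by exact_mod_cast (hN₀ N hN).2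
    have hword : ∀ p, μ {x | ((N + 2 - ℓ N p : ℕ) : ℕ∞) ≤ W (seg y p (ℓ N p)) x} ≤
        ENNReal.ofReal (1 / (N : ℝ) ^ 3) := by
      intro p
      obtain ⟨h1, -, h3⟩ := hℓ N hN p
      rw [exp_neg_info (measure_cyl_seg_pos hμ hy _ _)] at h3
      rw [← ENNReal.ofReal_toReal (measure_ne_top μ {x | _})]
      refine ENNReal.ofReal_le_ofReal ((hKB.2.2 _ _ _).trans ?_)
      have hcast : ((N + 2 - ℓ N p : ℕ) : ℝ) - 1 = N - ℓ N p + 1 := by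
        rw [Nat.cast_sub (by omega)]
        push_cast
        ring
      rw [hcast]
      calc _ ≤ Real.exp (-(3 * Real.log N)) := by gcongr
        _ = 1 / (N : ℝ) ^ 3 := by
          rw [Real.exp_neg, ← Real.log_rpow hNpos, Real.exp_log (by positivity), one_div]
          norm_cast
    calc μ (S N) ≤ μ (⋃ p ∈ Finset.range N,
          {x | ((N + 2 - ℓ N p : ℕ) : ℕ∞) ≤ W (seg y p (ℓ N p)) x}) := by
          refine measure_mono ?_
          rintro x ⟨-, p, hp, hx⟩
          exact Set.mem_biUnion (Finset.mem_range.2 hp) hx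
      _ ≤ ∑ p ∈ Finset.range N, ENNReal.ofReal (1 / (N : ℝ) ^ 3) :=
          (measure_biUnion_finset_le _ _).trans (Finset.sum_le_sum fun p _ => hword p)
      _ = ENNReal.ofReal (1 / (N : ℝ) ^ 2) := by
          rw [Finset.sum_const, Finset.card_range, nsmul_eq_mul, ← ENNReal.ofReal_natCast,
            ← ENNReal.ofReal_mul hNpos.le]
          congr 1
          field_simp
  have hsum : ∑' N, μ (S N) ≠ ⊤ :=
    ne_top_of_le_ne_top
      ((Real.summable_one_div_nat_pow.2 one_lt_two).tsum_ofReal_ne_top)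
      (ENNReal.tsum_le_tsum hSle)
  filter_upwards [ae_eventually_notMem hsum] with x hx
  filter_upwards [hx, eventually_ge_atTop N₀] with N hxN hN p hp
  obtain ⟨h1, h2, -⟩ := hℓ N hN p
  refine ⟨ℓ N p, h2, appears_of_W_lt h1 (not_le.1 fun hle => hxN ⟨hN, p, hp, hle⟩)⟩

end WaitingTimes

section UpperBound

theorem ZMest_nonneg {A : Type*} (N : ℕ) (x y : ℕ → A) : 0 ≤ ZMest N x y := by
  unfold ZMest
  positivity

theorem eventually_ZMest_le {A : Type*} {G : ℕ → ℕ → ℝ} {k : ℕ → ℝ} {C h ε : ℝ} {x y : ℕ → A}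
    (hG : AlmostAdditive G k C) (hk : k =o[atTop] fun n => (n : ℝ)) (hε : 0 < ε)
    (hε2 : ε < 1 / 2) (hinfo : ∀ᶠ N : ℕ in atTop, G 0 N ≤ (h + ε) * N)
    (hmatch : ∀ᶠ N : ℕ in atTop, ∀ p < N, ∃ ℓ, (1 - ε) * Real.log N ≤ G p ℓ ∧
      appears N x (seg y p ℓ)) :
    ∀ᶠ N in atTop, ZMest N x y ≤ (h + 3 * ε) / (1 - 2 * ε) := by
  obtain ⟨K, hK0, hK⟩ := exists_le_mul_add_of_isLittleO hk hε
  have hlog : Tendsto (fun N : ℕ => Real.log N) atTop atTop :=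
    Real.tendsto_log_atTop.comp tendsto_natCast_atTop_atTop
  have hlogN := (Real.isLittleO_log_id_atTop.comp_tendsto
    (tendsto_natCast_atTop_atTop (R := ℝ))).def hε
  filter_upwards [hinfo, hmatch, hlogN, hlog.eventually (eventually_ge_atTop (K / ε)),
    eventually_gt_atTop 0] with N h1 h2 h3 h4 hN
  have hN' : (0 : ℝ) < N := by exact_mod_cast hN
  have hL : 0 ≤ Real.log N := Real.log_natCast_nonneg N
  have hcount := cN_mul_le hG hK hε.le hK0 (mul_nonneg (by linarith : 0 ≤ 1 - ε) hL) h2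
  simp only [Function.comp_apply, id_eq, Real.norm_eq_abs, Nat.abs_cast, abs_of_nonneg hL] at h3
  rw [div_le_iff₀' hε] at h4
  have hε0 : 0 < 1 - 2 * ε := by linarith
  have hle : (cN N x y : ℝ) * ((1 - 2 * ε) * Real.log N) ≤ (h + 3 * ε) * N :=
    calc (cN N x y : ℝ) * ((1 - 2 * ε) * Real.log N)
        ≤ cN N x y * ((1 - ε) * Real.log N - K) := by gcongr; linarith
      _ ≤ (h + 3 * ε) * N := by nlinarith
  rw [ZMest, div_le_div_iff₀ hN' hε0]
  linarith

variable {A : Type*} [MeasurableSpace A] [Fintype A] {μ ν : Measure (ℕ → A)}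
  [IsProbabilityMeasure μ] [IsProbabilityMeasure ν]

theorem ae_ae_limsup_ZMest_le {k κ τ : ℕ → ℝ} {γ h : ℝ} (hμ : MeasurePreserving shift μ μ)
    (hν : Ergodic shift ν) (hk : CondID μ k) (hγ : CondFE μ γ) (hKB : CondKB μ κ τ)
    (hsupp : suppSet ν ⊆ suppSet μ) (hh : Tendsto (fun n => hcSeq μ ν n) atTop (nhds h)) :
    ∀ᵐ y ∂ν, ∀ᵐ x ∂μ, atTop.limsup (fun N => ZMest N x y) ≤ h := by
  have hcyl : ∀ n (a : Fin n → A), NullMeasurableSet (cyl a) ν :=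
    fun n a => nullMeasurableSet_cyl hKB hν.toMeasurePreserving hsupp a
  set e : ℕ → ℝ := fun n => 1 / ((n : ℝ) + 3) with he
  have he0 : ∀ n, 0 < e n := fun n => by positivity
  have he2 : ∀ n, e n < 1 / 2 := fun n => by
    have : (0 : ℝ) ≤ n := n.cast_nonneg
    exact one_div_lt_one_div_of_lt two_pos (by linarith)
  have helim : Tendsto e atTop (nhds 0) :=
    tendsto_const_nhds.div_atTop (tendsto_atTop_add_const_right _ _ tendsto_natCast_atTop_atTop)
  have hlim : Tendsto (fun n => (h + 3 * e n) / (1 - 2 * e n)) atTop (nhds h) := by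
    have := (tendsto_const_nhds (x := h)).add (helim.const_mul 3)
    have := this.div ((tendsto_const_nhds (x := (1 : ℝ))).sub (helim.const_mul 2)) (by norm_num)
    simpa using! this
  filter_upwards [ae_mem_suppSet ν,
    ae_all_iff.2 fun n => ae_eventually_info_le hμ hk hν hsupp hcyl hh (he0 n)] with y hy hinfo
  have hy' := hsupp hy
  filter_upwards [ae_all_iff.2 fun n => ae_eventually_appears hμ hk hγ hKB hy' (he0 n)
    ((he2 n).trans one_half_lt_one)] with x hx
  refine ge_of_tendsto' hlim fun n => ?_
  exact limsup_le_of_le (isBoundedUnder_of ⟨0, fun N => ZMest_nonneg N x y⟩).isCoboundedUnder_le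
    (eventually_ZMest_le (almostAdditive_info hμ hk hy') hk.2.1 (he0 n) (he2 n) (hinfo n) (hx n))

end UpperBound

/-- **Upper bound.** Under (ID), (FE), (KB) for `ℙ`, `ℚ` ergodic with `supp ℚ ⊆ supp ℙ`,
the specific cross entropy exists and is finite, and `limsup_N Q̂_N(y,x) ≤ h_c(ℚ|ℙ)` for
`ℚ`-a.e. `y` and `ℙ`-a.e. `x`. -/
theorem ZM_upper_bound {A : Type*} [Fintype A] [MeasurableSpace A]
    (μP μQ : Measure (ℕ → A)) [IsProbabilityMeasure μP] [IsProbabilityMeasure μQ]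
    (hPstat : MeasurePreserving shift μP μP)
    (hQerg : Ergodic shift μQ)
    (kP kKB τKB : ℕ → ℝ) (γP : ℝ)
    (hPID : CondID μP kP) (hPFE : CondFE μP γP) (hPKB : CondKB μP kKB τKB)
    (hsupp : suppSet μQ ⊆ suppSet μP) :
    ∃ h : ℝ, 0 ≤ h ∧ Tendsto (fun n => hcSeq μP μQ n) atTop (nhds h) ∧
      ∀ᵐ y ∂μQ, ∀ᵐ x ∂μP, atTop.limsup (fun N => ZMest N x y) ≤ h := by
  have hcyl : ∀ n (a : Fin n → A), NullMeasurableSet (cyl a) μQ :=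
    fun n a => nullMeasurableSet_cyl hPKB hQerg.toMeasurePreserving hsupp a
  obtain ⟨h, h0, hh⟩ := exists_tendsto_hcSeq hPstat hPID hQerg.toMeasurePreserving hsupp hcyl
  exact ⟨h, h0, hh, ae_ae_limsup_ZMest_le hPstat hQerg hPID hPFE hPKB hsupp hh⟩

end ZM
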